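/- For any bounded linear operator T on a complex Hilbert space and any polynomial P, the essential spectrum of P(T) equals the image P(σₑ(T)) of the essential spectrum of T under P. -/

import Mathlib

def IsFredholm {H : Type*} [NormedAddCommGroup H] [InnerProductSpace ℂ H]
    (T : H →L[ℂ] H) : Prop :=
  FiniteDimensional ℂ (LinearMap.ker (T : H →ₗ[ℂ] H)) ∧
  IsClosed (LinearMap.range (T : H →ₗ[ℂ] H) : Set H) ∧
  FiniteDimensional ℂ (H ⧸ LinearMap.range (T : H →ₗ[ℂ] H))

/-- The essential spectrum of a bounded operator. -/
def essSpec {H : Type*} [NormedAddCommGroup H] [InnerProductSpace ℂ H]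
    (T : H →L[ℂ] H) : Set ℂ :=
  {l : ℂ | ¬ IsFredholm (T - l • 1)}


section helpers

variable {H : Type*} [NormedAddCommGroup H] [InnerProductSpace ℂ H] [CompleteSpace H]

theorem isFredholm_iff_mathlib (T : H →L[ℂ] H) :
    IsFredholm T ↔ ContinuousLinearMap.IsFredholm T := by
  constructor
  · rintro ⟨h1, h2, h3⟩
    refine ⟨?_, h2, h1, h3, ?_⟩
    · rw [Topology.isStrictMap_iff_isQuotientMap_rangeFactorization]
      have : CompleteSpace (LinearMap.range (T : H →ₗ[ℂ] H)) := h2.completeSpace_coe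
      let g : H →L[ℂ] LinearMap.range (T : H →ₗ[ℂ] H) :=
        T.codRestrict (LinearMap.range (T : H →ₗ[ℂ] H)) (fun x => ⟨x, rfl⟩)
      have hg : Function.Surjective g := by
        rintro ⟨_, x, rfl⟩
        exact ⟨x, rfl⟩
      exact g.isQuotientMap hg
    · exact Submodule.ClosedComplemented.of_finiteDimensional _
  · intro h
    exact ⟨h.finite_ker, h.isClosed_range, h.finite_coker⟩

/-- Finite rank operators, as a two-sided ideal. -/
def finRankIdeal (H : Type*) [NormedAddCommGroup H] [InnerProductSpace ℂ H] :
    Ideal (H →L[ℂ] H) where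
  carrier := {f | (f : H →ₗ[ℂ] H).HasFiniteRange}
  add_mem' hf hg := LinearMap.HasFiniteRange.add hf hg
  zero_mem' := LinearMap.HasFiniteRange.zero
  smul_mem' c f hf := LinearMap.HasFiniteRange.comp_left hf (c : H →ₗ[ℂ] H)

instance finRankIdeal_isTwoSided (H : Type*) [NormedAddCommGroup H] [InnerProductSpace ℂ H] :
    (finRankIdeal H).IsTwoSided :=
  ⟨fun {f} c hf => LinearMap.HasFiniteRange.comp_right
    (show (f : H →ₗ[ℂ] H).HasFiniteRange from hf) (c : H →ₗ[ℂ] H)⟩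

theorem isFredholm_iff_exists (T : H →L[ℂ] H) :
    IsFredholm T ↔ ∃ S : H →L[ℂ] H, S * T - 1 ∈ finRankIdeal H ∧ T * S - 1 ∈ finRankIdeal H := by
  rw [isFredholm_iff_mathlib, ContinuousLinearMap.isFredholm_iff_exists_isQuasiInverse]
  refine exists_congr fun S => ?_
  constructor
  · rintro ⟨h1, h2⟩
    exact ⟨LinearMap.FiniteRangeSetoid.equiv_iff_hasFiniteRange.mp h1,
      LinearMap.FiniteRangeSetoid.equiv_iff_hasFiniteRange.mp h2⟩
  · rintro ⟨h1, h2⟩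
    exact ⟨LinearMap.FiniteRangeSetoid.equiv_iff_hasFiniteRange.mpr h1,
      LinearMap.FiniteRangeSetoid.equiv_iff_hasFiniteRange.mpr h2⟩

theorem isFredholm_iff_isUnit (T : H →L[ℂ] H) :
    IsFredholm T ↔ IsUnit (Ideal.Quotient.mkₐ ℂ (finRankIdeal H) T) := by
  rw [isFredholm_iff_exists, isUnit_iff_exists]
  constructor
  · rintro ⟨S, h1, h2⟩
    refine ⟨Ideal.Quotient.mkₐ ℂ (finRankIdeal H) S, ?_, ?_⟩
    · rw [← map_mul, ← map_one (Ideal.Quotient.mkₐ ℂ (finRankIdeal H))]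
      exact Ideal.Quotient.eq.mpr h2
    · rw [← map_mul, ← map_one (Ideal.Quotient.mkₐ ℂ (finRankIdeal H))]
      exact Ideal.Quotient.eq.mpr h1
  · rintro ⟨s, h1, h2⟩
    obtain ⟨S, rfl⟩ := Ideal.Quotient.mkₐ_surjective ℂ (finRankIdeal H) s
    rw [← map_mul, ← map_one (Ideal.Quotient.mkₐ ℂ (finRankIdeal H))] at h1 h2
    exact ⟨S, Ideal.Quotient.eq.mp h2, Ideal.Quotient.eq.mp h1⟩

theorem essSpec_eq_spectrum (T : H →L[ℂ] H) :
    essSpec T = spectrum ℂ (Ideal.Quotient.mkₐ ℂ (finRankIdeal H) T) := by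
  ext l
  rw [essSpec, Set.mem_setOf_eq, isFredholm_iff_isUnit, spectrum.mem_iff, not_iff_not,
    IsUnit.sub_iff, map_sub, map_smul, map_one, Algebra.algebraMap_eq_smul_one]

theorem isCompactOperator_of_mem_finRankIdeal {f : H →L[ℂ] H} (hf : f ∈ finRankIdeal H) :
    f ∈ compactOperator (RingHom.id ℂ) H H := by
  have hf' : (LinearMap.range (f : H →ₗ[ℂ] H)).FG := hf
  have : FiniteDimensional ℂ (LinearMap.range (f : H →ₗ[ℂ] H)) := Module.Finite.of_fg hf'
  have : ProperSpace (LinearMap.range (f : H →ₗ[ℂ] H)) := FiniteDimensional.proper ℂ _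
  let g : H →L[ℂ] LinearMap.range (f : H →ₗ[ℂ] H) :=
    f.codRestrict (LinearMap.range (f : H →ₗ[ℂ] H)) (fun x => ⟨x, rfl⟩)
  exact (isCompactOperator_of_locallyCompactSpace_dom g).clm_comp
    (LinearMap.range (f : H →ₗ[ℂ] H)).subtypeL

instance isClosed_compactOperator :
    IsClosed (compactOperator (RingHom.id ℂ) H H : Set (H →L[ℂ] H)) :=
  isClosed_setOfPred_isCompactOperator

/-- Left multiplication by an operator on the Calkin space. -/
noncomputable def calkinLeft (T : H →L[ℂ] H) :
    ((H →L[ℂ] H) ⧸ compactOperator (RingHom.id ℂ) H H) →L[ℂ]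
      ((H →L[ℂ] H) ⧸ compactOperator (RingHom.id ℂ) H H) :=
  Submodule.liftQL _
    ((compactOperator (RingHom.id ℂ) H H).mkQL.comp (ContinuousLinearMap.mul ℂ (H →L[ℂ] H) T))
    (by
      intro f hf
      have hf' : IsCompactOperator f := hf
      have : T * f ∈ compactOperator (RingHom.id ℂ) H H := hf'.clm_comp T
      rw [LinearMap.mem_ker]
      exact (Submodule.Quotient.mk_eq_zero _).mpr this)

theorem calkinLeft_mk (T f : H →L[ℂ] H) :
    calkinLeft T (Submodule.Quotient.mk f) = Submodule.Quotient.mk (T * f) := rfl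

theorem calkinLeft_comp {S T : H →L[ℂ] H} (h : S * T - 1 ∈ finRankIdeal H) :
    calkinLeft S * calkinLeft T = 1 := by
  ext x
  obtain ⟨f, rfl⟩ := Submodule.Quotient.mk_surjective _ x
  rw [ContinuousLinearMap.mul_apply, ContinuousLinearMap.one_apply, calkinLeft_mk, calkinLeft_mk, Submodule.Quotient.eq]
  have := isCompactOperator_of_mem_finRankIdeal
    ((finRankIdeal H).mul_mem_right f h)
  rwa [sub_mul, one_mul, mul_assoc] at this

theorem calkinLeft_sub (T : H →L[ℂ] H) (l : ℂ) :
    calkinLeft (T - l • 1) = calkinLeft T - algebraMap ℂ _ l := by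
  ext x
  obtain ⟨f, rfl⟩ := Submodule.Quotient.mk_surjective _ x
  rw [Algebra.algebraMap_eq_smul_one]
  rw [ContinuousLinearMap.sub_apply, ContinuousLinearMap.smul_apply,
    ContinuousLinearMap.one_apply, calkinLeft_mk, calkinLeft_mk, sub_mul, smul_mul_assoc, one_mul]
  rfl

theorem finiteDimensional_of_essSpec_empty (T : H →L[ℂ] H) (h : essSpec T = ∅) :
    FiniteDimensional ℂ H := by
  by_contra hH
  have hne : Nontrivial ((H →L[ℂ] H) ⧸ compactOperator (RingHom.id ℂ) H H) := by
    rw [Submodule.Quotient.nontrivial_iff]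
    intro htop
    apply hH
    have h1 : (1 : H →L[ℂ] H) ∈ compactOperator (RingHom.id ℂ) H H := htop ▸ Submodule.mem_top
    have h2 : IsCompactOperator (id : H → H) := h1
    have := isCompactOperator_id_iff_locallyCompactSpace.mp h2
    exact FiniteDimensional.of_locallyCompactSpace ℂ
  obtain ⟨l, hl⟩ := spectrum.nonempty (calkinLeft T)
  have hF : IsFredholm (T - l • 1) := by
    by_contra hc
    have : l ∈ essSpec T := hc
    rw [h] at this
    exact this
  obtain ⟨S, h1, h2⟩ := (isFredholm_iff_exists _).mp hF
  rw [spectrum.mem_iff, IsUnit.sub_iff, ← calkinLeft_sub] at hl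
  exact hl (isUnit_iff_exists.mpr ⟨_, calkinLeft_comp h2, calkinLeft_comp h1⟩)

end helpers

/-- Essential Spectrum Mapping Theorem: for any bounded operator T on a complex
Hilbert space and any polynomial P, σₑ(P(T)) = P(σₑ(T)). -/
theorem essential_spectrum_mapping {H : Type*} [NormedAddCommGroup H]
    [InnerProductSpace ℂ H] [CompleteSpace H]
    (T : H →L[ℂ] H) (P : Polynomial ℂ) :
    essSpec (Polynomial.aeval T P) = (fun z => Polynomial.eval z P) '' essSpec T := by
  rcases (essSpec T).eq_empty_or_nonempty with h | h
  · have := finiteDimensional_of_essSpec_empty T h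
    rw [h, Set.image_empty, Set.eq_empty_iff_forall_notMem]
    intro l hl
    refine hl ⟨inferInstance, Submodule.closed_of_finiteDimensional _, inferInstance⟩
  · rw [essSpec_eq_spectrum] at h
    rw [essSpec_eq_spectrum, essSpec_eq_spectrum, ← spectrum.map_polynomial_aeval_of_nonempty _ _ h,
      Polynomial.aeval_algHom_apply]
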